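/- For every natural number k with k ≡ 2 (mod 4), if the complex number √2 belongs to the field ℚ(e^{iπ/k}), then the complex number e^{iπ/(2k)} also belongs to ℚ(e^{iπ/k}). -/

import Mathlib

open Complex IntermediateField

theorem Complex.exp_neg_pi_div_four_mul_I :
    Complex.exp (-(Real.pi / 4) * Complex.I) = Real.sqrt 2 * (1 - Complex.I) / 2 := by
  have hc : Complex.cos (Real.pi / 4) = (Real.sqrt 2 : ℂ) / 2 := by
    exact_mod_cast congrArg Complex.ofReal Real.cos_pi_div_four
  have hs : Complex.sin (Real.pi / 4) = (Real.sqrt 2 : ℂ) / 2 := by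
    exact_mod_cast congrArg Complex.ofReal Real.sin_pi_div_four
  rw [Complex.exp_mul_I, Complex.cos_neg, Complex.sin_neg, hc, hs]
  ring

/-- For `k ≡ 2 (mod 4)`, if `√2 ∈ ℚ(e^{iπ/k})` then `e^{iπ/(2k)} ∈ ℚ(e^{iπ/k})`. -/
theorem exp_half_mem_adjoin_of_sqrt_two_mem (k : ℕ) (hk : k % 4 = 2)
    (h : (Real.sqrt 2 : ℂ) ∈
      IntermediateField.adjoin ℚ ({Complex.exp (Real.pi * Complex.I / k)} : Set ℂ)) :
    Complex.exp (Real.pi * Complex.I / (2 * k)) ∈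
      IntermediateField.adjoin ℚ ({Complex.exp (Real.pi * Complex.I / k)} : Set ℂ) := by
  obtain ⟨m, rfl⟩ : ∃ m, k = 4 * m + 2 := ⟨k / 4, by omega⟩
  set K := IntermediateField.adjoin ℚ
    ({Complex.exp (Real.pi * Complex.I / (4 * m + 2 : ℕ))} : Set ℂ)
  have hz : Complex.exp (Real.pi * Complex.I / (4 * m + 2 : ℕ)) ∈ K :=
    IntermediateField.mem_adjoin_simple_self ℚ _
  have hk0 : (4 * m + 2 : ℂ) ≠ 0 := by exact_mod_cast (by omega : 4 * m + 2 ≠ 0)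
  have hm0 : (2 * m + 1 : ℂ) ≠ 0 := by exact_mod_cast (by omega : 2 * m + 1 ≠ 0)
  have hI : Complex.I ∈ K := by
    have e : Complex.exp (Real.pi * Complex.I / (4 * m + 2 : ℕ)) ^ (2 * m + 1) = Complex.I := by
      rw [← Complex.exp_nat_mul]
      refine Eq.trans ?_ Complex.exp_pi_div_two_mul_I
      congr 1
      push_cast
      rw [show (4 * m + 2 : ℂ) = 2 * (2 * m + 1) by ring]
      field_simp
    exact e ▸ pow_mem hz _
  have e : Complex.exp (Real.pi * Complex.I / (2 * (4 * m + 2 : ℕ))) =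
      Complex.exp (Real.pi * Complex.I / (4 * m + 2 : ℕ)) ^ (m + 1) *
        (Real.sqrt 2 * (1 - Complex.I) / 2) := by
    rw [← Complex.exp_neg_pi_div_four_mul_I, ← Complex.exp_nat_mul, ← Complex.exp_add]
    congr 1
    push_cast
    field_simp
    ring
  rw [e]
  exact mul_mem (pow_mem hz _)
    (div_mem (mul_mem h (sub_mem (one_mem K) hI)) (ofNat_mem K 2))
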